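/- Coboundary characterization of γ = 0: Let f : 𝕋 → 𝕋 be a C^∞ map of the circle with f' ≥ λ for some λ > 1, let ρ⋆ be the density of its unique absolutely continuous invariant probability measure, let b ∈ C^∞(𝕋,ℝ) with ∫_𝕋 b ρ⋆ dθ = 0, and let γ = ∫_𝕋 b² ρ⋆ dθ + 2∑_{k=1}^∞ ∫_𝕋 b·(b∘f^k)·ρ⋆ dθ. Then γ = 0 if and only if b is a continuous coboundary, i.e. there exists ζ ∈ C⁰(𝕋,ℝ) with b = ζ − ζ∘f. -/

import Mathlib

/-!
Statement 18: Coboundary characterization of `γ = 0` (Lemma B.2 of the paper):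
`γ = 0` if and only if `b` is a continuous coboundary, `b = ζ − ζ∘f`.
-/

open MeasureTheory

noncomputable section

/-- The Green–Kubo covariance
`γ = ∫ b² ρ⋆ + 2 ∑_{k≥1} ∫ b (b∘f^k) ρ⋆`. -/
def gammaCoef (F b ρstar : ℝ → ℝ) : ℝ :=
  (∫ x in (0:ℝ)..1, b x ^ 2 * ρstar x)
    + 2 * ∑' k : ℕ, ∫ x in (0:ℝ)..1, b x * b (F^[k + 1] x) * ρstar x

open Finset

/-! ### Periodic functions -/

lemma Function.Periodic.comp_lift {F g : ℝ → ℝ} {n : ℕ} (hg : Function.Periodic g 1)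
    (hF : ∀ x, F (x + 1) = F x + n) : Function.Periodic (fun x => g (F x)) 1 := by
  intro x
  have := hg.nat_mul n (F x)
  simp only [mul_one] at this
  simp only [hF, this]

lemma Function.Periodic.exists_abs_le {g : ℝ → ℝ} (hg : Function.Periodic g 1)
    (hc : Continuous g) : ∃ K, 0 ≤ K ∧ ∀ x, |g x| ≤ K := by
  obtain ⟨K, hK⟩ := isCompact_Icc.exists_bound_of_continuousOn (s := Set.Icc (0 : ℝ) 1)
    hc.continuousOn
  refine ⟨K, (norm_nonneg _).trans (hK 0 (by simp)), fun x => ?_⟩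
  obtain ⟨y, hy, hxy⟩ := hg.exists_mem_Ico₀ one_pos x
  rw [hxy]
  exact hK y ⟨hy.1, hy.2.le⟩

lemma Function.Periodic.deriv_one {g : ℝ → ℝ} (hg : Function.Periodic g 1) :
    Function.Periodic (deriv g) 1 := by
  intro x
  rw [← deriv_comp_add_const]
  congr 1
  exact funext hg

lemma Function.Periodic.exists_lipschitz {g : ℝ → ℝ} (hg : Function.Periodic g 1)
    (hc : ContDiff ℝ 1 g) : ∃ K, 0 ≤ K ∧ ∀ x y, |g x - g y| ≤ K * |x - y| := by
  obtain ⟨K, hK0, hK⟩ := hg.deriv_one.exists_abs_le (hc.continuous_deriv le_rfl)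
  refine ⟨K, hK0, fun x y => ?_⟩
  exact Convex.norm_image_sub_le_of_norm_deriv_le (s := Set.univ)
    (fun x _ => (hc.differentiable one_ne_zero) x) (fun x _ => hK x) convex_univ
    (Set.mem_univ y) (Set.mem_univ x)

/-- A bound on differences by a monotone modulus at distance at most one extends to all pairs of
points. -/
lemma Function.Periodic.sub_le_of_dist_le_one {g ω : ℝ → ℝ} (hg : Function.Periodic g 1)
    (hω : Monotone ω) (h : ∀ x y, |x - y| ≤ 1 → g x - g y ≤ ω |x - y|) (x y : ℝ) :
    g x - g y ≤ ω |x - y| := by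
  rcases le_total |x - y| 1 with hxy | hxy
  · exact h x y hxy
  · obtain ⟨z, hz, hxz⟩ := hg.exists_mem_Ico one_pos x y
    have hzy : |z - y| ≤ 1 := by rw [abs_of_nonneg (by linarith [hz.1])]; linarith [hz.2]
    rw [hxz]
    exact (h z y hzy).trans (hω (hzy.trans hxy))

lemma eq_zero_of_integral_mul_sq_eq_zero {ρ g : ℝ → ℝ} (hρ : Continuous ρ) (hρpos : ∀ x, 0 < ρ x)
    (hg : Continuous g) (hper : Function.Periodic g 1)
    (h0 : ∫ x in (0 : ℝ)..1, ρ x * g x ^ 2 = 0) (x : ℝ) : g x = 0 := by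
  by_contra hx
  obtain ⟨y, hy, hxy⟩ := hper.exists_mem_Ico₀ one_pos x
  have := intervalIntegral.integral_pos (f := fun x => ρ x * g x ^ 2) (a := 0) (b := 1) one_pos
    (by fun_prop) (fun z _ => mul_nonneg (hρpos z).le (sq_nonneg _))
    ⟨y, ⟨hy.1, hy.2.le⟩, mul_pos (hρpos y) (by rw [← hxy]; positivity)⟩
  exact this.ne' h0

/-! ### An exponential modulus of continuity -/

lemma half_le_one_sub_exp_neg {t : ℝ} (h0 : 0 ≤ t) (h1 : t ≤ 1) : t / 2 ≤ 1 - Real.exp (-t) := by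
  have h : Real.exp (-t) * (1 + t) ≤ 1 := by
    calc Real.exp (-t) * (1 + t) ≤ Real.exp (-t) * Real.exp t := by
          gcongr; linarith [Real.add_one_le_exp t]
      _ = 1 := by rw [← Real.exp_add]; simp
  nlinarith [Real.exp_pos (-t)]

/-- The modulus `1 - exp (-A t)` is contracted by a coupling which succeeds with probability
`exp (-C t)` and then divides distances by `lam`. -/
lemma exists_modulus_contraction {lam C : ℝ} (hlam : 1 < lam) (hC : 0 ≤ C) :
    ∃ A r : ℝ, 1 ≤ A ∧ 0 < r ∧ r < 1 ∧ ∀ t, 0 ≤ t → t ≤ 1 →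
      Real.exp (-(C * t)) * (1 - Real.exp (-(A * (t / lam)))) + (1 - Real.exp (-(C * t)))
        ≤ r * (1 - Real.exp (-(A * t))) := by
  have hlam0 : 0 < lam := by linarith
  obtain ⟨κ, hκ⟩ : ∃ κ, κ = 1 - lam⁻¹ := ⟨_, rfl⟩
  have hinv : 0 < lam⁻¹ := by positivity
  have hκ0 : 0 < κ := by
    rw [hκ, sub_pos]
    exact inv_lt_one_of_one_lt₀ hlam
  have hκ1 : κ < 1 := by linarith
  obtain ⟨A, hA⟩ : ∃ A, A = (2 * C + 1) / κ := ⟨_, rfl⟩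
  have hAκ : A * κ = 2 * C + 1 := by rw [hA]; field_simp
  have hA1 : 1 ≤ A := by
    by_contra! h
    nlinarith
  refine ⟨A, 1 - Real.exp (-C - A) / (2 * A), hA1, ?_, ?_, ?_⟩
  · rw [sub_pos, div_lt_one (by positivity)]
    have : Real.exp (-C - A) ≤ 1 := Real.exp_le_one_iff.2 (by linarith)
    linarith
  · have : 0 < Real.exp (-C - A) / (2 * A) := by positivity
    linarith
  · intro t ht0 ht1
    have e1 : A * (t / lam) = A * t - A * κ * t := by rw [hκ]; field_simp; ring
    set u := Real.exp (-(A * (t / lam))) with hu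
    have hAt : Real.exp (-(A * t)) = u * Real.exp (-((2 * C + 1) * t)) := by
      rw [hu, ← Real.exp_add, e1, hAκ]; congr 1; ring
    have hsplit : Real.exp (-((2 * C + 1) * t))
        = Real.exp (-(C * t)) * Real.exp (-((C + 1) * t)) := by
      rw [← Real.exp_add]; congr 1; ring
    have hgap : t / 2 ≤ 1 - Real.exp (-((C + 1) * t)) := by
      have : Real.exp (-((C + 1) * t)) ≤ Real.exp (-t) := Real.exp_le_exp.2 (by nlinarith)
      linarith [half_le_one_sub_exp_neg ht0 ht1]
    have hCt : Real.exp (-C) ≤ Real.exp (-(C * t)) := Real.exp_le_exp.2 (by nlinarith)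
    have hu1 : Real.exp (-A) ≤ u := by
      refine Real.exp_le_exp.2 (neg_le_neg ?_)
      have : t / lam ≤ 1 := by rw [div_le_one hlam0]; linarith
      nlinarith
    have hD : 1 - Real.exp (-(A * t)) ≤ A * t := by
      linarith [Real.add_one_le_exp (-(A * t))]
    have hlhs : Real.exp (-C - A) / (2 * A) * (1 - Real.exp (-(A * t)))
        ≤ Real.exp (-C) * Real.exp (-A) * (t / 2) := by
      calc _ ≤ Real.exp (-C - A) / (2 * A) * (A * t) := by gcongr
        _ = Real.exp (-C - A) * (t / 2) := by field_simp
        _ = _ := by rw [sub_eq_add_neg, Real.exp_add]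
    have hrhs : Real.exp (-C) * Real.exp (-A) * (t / 2)
        ≤ Real.exp (-(C * t)) * u * (1 - Real.exp (-((C + 1) * t))) := by
      gcongr
    have hid : Real.exp (-(C * t)) * u * (1 - Real.exp (-((C + 1) * t)))
        = Real.exp (-(C * t)) * u - Real.exp (-(A * t)) := by
      rw [hAt, hsplit]; ring
    linarith

/-- Comparison of two averages whose weights overlap. -/
lemma sum_mul_sub_sum_mul_le {ι : Type*} {s : Finset ι} {p q a a' : ι → ℝ} {c D H : ℝ}
    (hs : s.Nonempty) (hp : ∀ i ∈ s, 0 ≤ p i) (hp1 : ∑ i ∈ s, p i = 1) (hq1 : ∑ i ∈ s, q i = 1)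
    (hc : 0 ≤ c) (hpq : ∀ i ∈ s, c * p i ≤ q i) (hD : ∀ i ∈ s, a i - a' i ≤ D)
    (hH : ∀ i ∈ s, ∀ j ∈ s, a i - a' j ≤ H) :
    ∑ i ∈ s, p i * a i - ∑ i ∈ s, q i * a' i ≤ c * D + (1 - c) * H := by
  have hc1 : 0 ≤ 1 - c := by
    have := Finset.sum_le_sum hpq
    rw [← Finset.mul_sum, hp1, hq1] at this
    linarith
  obtain ⟨k, hk, hmin⟩ := s.exists_min_image a' hs
  have h1 : ∑ i ∈ s, p i * (a i - a' i) ≤ D := by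
    calc _ ≤ ∑ i ∈ s, p i * D :=
          Finset.sum_le_sum fun i hi => mul_le_mul_of_nonneg_left (hD i hi) (hp i hi)
      _ = D := by rw [← Finset.sum_mul, hp1, one_mul]
  have h2 : ∑ i ∈ s, p i * a i ≤ a' k + H := by
    calc _ ≤ ∑ i ∈ s, p i * (a' k + H) := Finset.sum_le_sum fun i hi =>
          mul_le_mul_of_nonneg_left (by linarith [hH i hi k hk]) (hp i hi)
      _ = _ := by rw [← Finset.sum_mul, hp1, one_mul]
  have h3 : (1 - c) * a' k ≤ ∑ i ∈ s, (q i - c * p i) * a' i := by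
    calc (1 - c) * a' k = ∑ i ∈ s, (q i - c * p i) * a' k := by
          rw [← Finset.sum_mul, Finset.sum_sub_distrib, ← Finset.mul_sum, hp1, hq1, mul_one]
      _ ≤ _ := Finset.sum_le_sum fun i hi =>
          mul_le_mul_of_nonneg_left (hmin i hi) (by linarith [hpq i hi])
  have hid : ∑ i ∈ s, p i * a i - ∑ i ∈ s, q i * a' i
      = c * ∑ i ∈ s, p i * (a i - a' i) + (1 - c) * ∑ i ∈ s, p i * a i
        - ∑ i ∈ s, (q i - c * p i) * a' i := by
    simp only [Finset.mul_sum, ← Finset.sum_add_distrib, ← Finset.sum_sub_distrib]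
    exact Finset.sum_congr rfl fun i _ => by ring
  rw [hid]
  nlinarith [mul_le_mul_of_nonneg_left h1 hc, mul_le_mul_of_nonneg_left h2 hc1]

/-! ### The normalized transfer operator -/

/-- `F` is the lift of a uniformly expanding circle map of degree `n`, with inverse `G`, and `ρ` is
the density of an invariant probability measure. -/
structure IsExpandingLift (F G ρ : ℝ → ℝ) (n : ℕ) (lam : ℝ) : Prop where
  contDiff : ContDiff ℝ 2 F
  map_add_one : ∀ x, F (x + 1) = F x + n
  one_lt : 1 < lam
  le_deriv : ∀ x, lam ≤ deriv F x
  left_inv : ∀ x, G (F x) = x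
  right_inv : ∀ y, F (G y) = y
  density_periodic : Function.Periodic ρ 1
  density_contDiff : ContDiff ℝ 1 ρ
  density_pos : ∀ x, 0 < ρ x
  integral_density : ∫ x in (0 : ℝ)..1, ρ x = 1
  invariant : ∀ g : ℝ → ℝ, Continuous g → Function.Periodic g 1 →
    ∫ x in (0 : ℝ)..1, ρ x * g (F x) = ∫ x in (0 : ℝ)..1, ρ x * g x

/-- The transition probability from `y` to its preimage `G (y + j)`. -/
def branchWeight (F G ρ : ℝ → ℝ) (j : ℕ) (y : ℝ) : ℝ :=
  ρ (G (y + j)) / deriv F (G (y + j)) / ρ y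

/-- The transfer operator of `F`, normalized by the invariant density `ρ`. -/
def transferOp (F G ρ : ℝ → ℝ) (n : ℕ) (h : ℝ → ℝ) (y : ℝ) : ℝ :=
  ∑ j ∈ range n, branchWeight F G ρ j y * h (G (y + j))

namespace IsExpandingLift

variable {F G ρ : ℝ → ℝ} {n : ℕ} {lam : ℝ}

lemma deriv_pos (hE : IsExpandingLift F G ρ n lam) (x : ℝ) : 0 < deriv F x :=
  (zero_lt_one.trans hE.one_lt).trans_le (hE.le_deriv x)

lemma strictMono (hE : IsExpandingLift F G ρ n lam) : StrictMono F :=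
  strictMono_of_deriv_pos hE.deriv_pos

lemma continuous_deriv (hE : IsExpandingLift F G ρ n lam) : Continuous (deriv F) :=
  hE.contDiff.continuous_deriv (by norm_num)

lemma degree_pos (hE : IsExpandingLift F G ρ n lam) : 0 < n := by
  have h := hE.strictMono (show (0 : ℝ) < 0 + 1 by norm_num)
  rw [hE.map_add_one] at h
  exact_mod_cast (lt_add_iff_pos_right _).1 h

lemma deriv_periodic (hE : IsExpandingLift F G ρ n lam) : Function.Periodic (deriv F) 1 := by
  intro x
  rw [← deriv_comp_add_const, funext hE.map_add_one, deriv_add_const]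

lemma inv_add_degree (hE : IsExpandingLift F G ρ n lam) (y : ℝ) : G (y + n) = G y + 1 := by
  apply hE.strictMono.injective
  rw [hE.right_inv, hE.map_add_one, hE.right_inv]

lemma abs_inv_sub_le (hE : IsExpandingLift F G ρ n lam) (x y : ℝ) :
    |G x - G y| ≤ |x - y| / lam := by
  have key : ∀ x y, x ≤ y → |G x - G y| ≤ |x - y| / lam := by
    intro x y hxy
    have hG : G x ≤ G y := by
      rw [← hE.strictMono.le_iff_le, hE.right_inv, hE.right_inv]; exact hxy
    have := mul_sub_le_image_sub_of_le_deriv (hE.contDiff.differentiable two_ne_zero)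
      hE.le_deriv hG
    rw [hE.right_inv, hE.right_inv] at this
    rw [le_div_iff₀ (zero_lt_one.trans hE.one_lt), abs_sub_comm, abs_sub_comm x,
      abs_of_nonneg (sub_nonneg.2 hxy), abs_of_nonneg (sub_nonneg.2 hG)]
    linarith
  rcases le_total x y with h | h
  · exact key x y h
  · rw [abs_sub_comm, abs_sub_comm x]; exact key y x h

lemma continuous_inv (hE : IsExpandingLift F G ρ n lam) : Continuous G := by
  have hlam : 0 < lam := zero_lt_one.trans hE.one_lt
  refine LipschitzWith.continuous (K := Real.toNNReal lam⁻¹) (LipschitzWith.of_dist_le' ?_)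
  intro x y
  rw [Real.dist_eq, Real.dist_eq, mul_comm, ← div_eq_mul_inv]
  exact hE.abs_inv_sub_le x y

lemma branchWeight_pos (hE : IsExpandingLift F G ρ n lam) (j : ℕ) (y : ℝ) :
    0 < branchWeight F G ρ j y :=
  div_pos (div_pos (hE.density_pos _) (hE.deriv_pos _)) (hE.density_pos _)

lemma continuous_transferOp (hE : IsExpandingLift F G ρ n lam) {h : ℝ → ℝ} (hh : Continuous h) :
    Continuous (transferOp F G ρ n h) := by
  have h1 := hE.continuous_inv
  have h2 := hE.continuous_deriv
  have h3 := hE.density_contDiff.continuous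
  have h4 : ∀ x, deriv F x ≠ 0 := fun x => (hE.deriv_pos x).ne'
  have h5 : ∀ x, ρ x ≠ 0 := fun x => (hE.density_pos x).ne'
  unfold transferOp branchWeight
  fun_prop (disch := simp [h4])

lemma periodic_transferOp (hE : IsExpandingLift F G ρ n lam) {h : ℝ → ℝ}
    (hh : Function.Periodic h 1) : Function.Periodic (transferOp F G ρ n h) 1 := by
  intro y
  set k : ℕ → ℝ := fun j => branchWeight F G ρ j y * h (G (y + j)) with hk
  have hshift : ∀ j : ℕ, branchWeight F G ρ j (y + 1) * h (G (y + 1 + j)) = k (j + 1) := by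
    intro j
    have : y + 1 + (j : ℝ) = y + ((j + 1 : ℕ) : ℝ) := by push_cast; ring
    simp only [hk, branchWeight, this, hE.density_periodic y]
  have hend : k n = k 0 := by
    simp only [hk, branchWeight, hE.inv_add_degree, Nat.cast_zero, add_zero,
      hE.density_periodic (G y), hE.deriv_periodic (G y), hh (G y)]
  have := Finset.sum_range_succ k n
  rw [Finset.sum_range_succ' k n, hend] at this
  simp only [transferOp, hshift]
  exact add_right_cancel this

lemma integral_mul_comp (hE : IsExpandingLift F G ρ n lam) {h g : ℝ → ℝ} (hh : Continuous h)
    (hhp : Function.Periodic h 1) (hg : Continuous g) (hgp : Function.Periodic g 1) :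
    ∫ x in (0 : ℝ)..1, ρ x * (h x * g (F x))
      = ∫ x in (0 : ℝ)..1, ρ x * (transferOp F G ρ n h x * g x) := by
  have h1 := hE.continuous_inv
  have h2 := hE.continuous_deriv
  have h3 := hE.density_contDiff.continuous
  have h4 : ∀ x, deriv F x ≠ 0 := fun x => (hE.deriv_pos x).ne'
  have h5 : ∀ x, ρ x ≠ 0 := fun x => (hE.density_pos x).ne'
  set k : ℝ → ℝ := fun u => ρ (G u) / deriv F (G u) * h (G u) * g u with hk
  have hkc : Continuous k := by
    rw [hk]
    exact ((((h3.comp h1).div (h2.comp h1) fun _ => h4 _).mul (hh.comp h1)).mul hg)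
  have hsum : ∀ x, ρ x * (transferOp F G ρ n h x * g x) = ∑ j ∈ range n, k (x + j) := by
    intro x
    simp only [transferOp, branchWeight, Finset.sum_mul, Finset.mul_sum, hk]
    refine Finset.sum_congr rfl fun j _ => ?_
    have := hgp.nat_mul j x
    rw [mul_one] at this
    rw [this]
    have := h5 x
    field_simp
  have hper : Function.Periodic (fun x => ρ x * (transferOp F G ρ n h x * g x)) 1 :=
    hE.density_periodic.mul ((hE.periodic_transferOp hhp).mul hgp)
  have hF0 : F 1 = F 0 + n := by simpa using hE.map_add_one 0
  calc ∫ x in (0 : ℝ)..1, ρ x * (h x * g (F x))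
      = ∫ x in (0 : ℝ)..1, (k ∘ F) x * deriv F x := by
        refine intervalIntegral.integral_congr fun x _ => ?_
        have := h4 x
        simp only [hk, Function.comp, hE.left_inv]
        field_simp
    _ = ∫ u in F 0..F 1, k u := intervalIntegral.integral_comp_mul_deriv
        (fun x _ => (hE.contDiff.differentiable two_ne_zero x).hasDerivAt) h2.continuousOn hkc
    _ = ∑ j ∈ range n, ∫ u in (F 0 + (j : ℕ))..(F 0 + (j + 1 : ℕ)), k u := by
        rw [intervalIntegral.sum_integral_adjacent_intervals (a := fun j : ℕ => F 0 + (j : ℝ))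
          fun _ _ => hkc.intervalIntegrable _ _]
        simp [hF0]
    _ = ∑ j ∈ range n, ∫ u in F 0..(F 0 + 1), k (u + j) := by
        refine Finset.sum_congr rfl fun j _ => ?_
        rw [intervalIntegral.integral_comp_add_right k]
        congr 1
        push_cast; ring
    _ = ∫ u in F 0..(F 0 + 1), ∑ j ∈ range n, k (u + j) := by
        rw [intervalIntegral.integral_finsetSum]
        intro j _
        exact (hkc.comp (by fun_prop)).intervalIntegrable _ _
    _ = ∫ u in F 0..(F 0 + 1), ρ u * (transferOp F G ρ n h u * g u) := by simp only [hsum]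
    _ = ∫ u in (0 : ℝ)..(0 + 1), ρ u * (transferOp F G ρ n h u * g u) :=
        hper.intervalIntegral_add_eq _ _
    _ = _ := by rw [zero_add]

lemma sum_branchWeight (hE : IsExpandingLift F G ρ n lam) (y : ℝ) :
    ∑ j ∈ range n, branchWeight F G ρ j y = 1 := by
  have hc := hE.continuous_transferOp (h := fun _ => 1) continuous_const
  have hp := hE.periodic_transferOp (h := fun _ => 1) fun _ => rfl
  have hρ := hE.density_contDiff.continuous
  set e : ℝ → ℝ := fun x => transferOp F G ρ n (fun _ => 1) x - 1 with he
  have hec : Continuous e := hc.sub continuous_const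
  have hep : Function.Periodic e 1 := fun x => by simp only [he, hp x]
  have h1 := hE.integral_mul_comp (h := fun _ => 1) continuous_const (fun _ => rfl) hec hep
  simp only [one_mul] at h1
  rw [hE.invariant e hec hep] at h1
  have h0 : ∫ x in (0 : ℝ)..1, ρ x * e x ^ 2 = 0 := by
    refine Eq.trans ?_ (sub_eq_zero.2 h1.symm)
    rw [← intervalIntegral.integral_sub
      (Continuous.intervalIntegrable (by fun_prop) _ _)
      (Continuous.intervalIntegrable (by fun_prop) _ _)]
    refine intervalIntegral.integral_congr fun x _ => ?_
    simp only [he]; ring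
  have := eq_zero_of_integral_mul_sq_eq_zero hρ hE.density_pos hec hep h0 y
  simp only [he, transferOp, mul_one] at this
  linarith

lemma exists_distortion (hE : IsExpandingLift F G ρ n lam) :
    ∃ C, 0 ≤ C ∧ ∀ j x y, Real.exp (-(C * |x - y|)) * branchWeight F G ρ j x
      ≤ branchWeight F G ρ j y := by
  obtain ⟨K, hK0, hK⟩ := Function.Periodic.exists_lipschitz (g := fun x => Real.log (ρ x))
    (fun x => by simp only [hE.density_periodic x])
    (hE.density_contDiff.log fun x => (hE.density_pos x).ne')
  have hd : ContDiff ℝ 1 (deriv F) := by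
    have := hE.contDiff
    rw [show (2 : WithTop ℕ∞) = 1 + 1 by norm_num, contDiff_succ_iff_deriv] at this
    exact this.2.2
  obtain ⟨K', hK'0, hK'⟩ := Function.Periodic.exists_lipschitz
    (g := fun x => Real.log (deriv F x)) (fun x => by simp only [hE.deriv_periodic x])
    (hd.log fun x => (hE.deriv_pos x).ne')
  refine ⟨2 * K + K', by positivity, fun j x y => ?_⟩
  have hlog : ∀ z, Real.log (branchWeight F G ρ j z)
      = Real.log (ρ (G (z + j))) - Real.log (deriv F (G (z + j))) - Real.log (ρ z) := by
    intro z
    rw [branchWeight, Real.log_div (div_pos (hE.density_pos _) (hE.deriv_pos _)).ne'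
      (hE.density_pos _).ne', Real.log_div (hE.density_pos _).ne' (hE.deriv_pos _).ne']
  have hG : |G (x + j) - G (y + j)| ≤ |x - y| := by
    refine (hE.abs_inv_sub_le _ _).trans ?_
    rw [add_sub_add_right_eq_sub]
    exact div_le_self (abs_nonneg _) hE.one_lt.le
  have e1 := (hK (G (x + j)) (G (y + j))).trans (mul_le_mul_of_nonneg_left hG hK0)
  have e2 := (hK' (G (x + j)) (G (y + j))).trans (mul_le_mul_of_nonneg_left hG hK'0)
  have e3 := hK x y
  rw [← Real.exp_log (hE.branchWeight_pos j x), ← Real.exp_log (hE.branchWeight_pos j y),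
    ← Real.exp_add, Real.exp_le_exp, hlog, hlog]
  rw [abs_le] at e1 e2 e3
  linarith [e1.2, e2.1, e3.1]

/-- The transfer operator contracts a modulus of continuity. -/
lemma exists_contraction (hE : IsExpandingLift F G ρ n lam) :
    ∃ A r : ℝ, 1 ≤ A ∧ 0 < r ∧ r < 1 ∧ ∀ h : ℝ → ℝ, ∀ H : ℝ, 0 ≤ H → Function.Periodic h 1 →
      (∀ x y, h x - h y ≤ H * (1 - Real.exp (-(A * |x - y|)))) →
      ∀ x y, transferOp F G ρ n h x - transferOp F G ρ n h y
        ≤ H * r * (1 - Real.exp (-(A * |x - y|))) := by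
  obtain ⟨C, hC0, hC⟩ := hE.exists_distortion
  obtain ⟨A, r, hA, hr0, hr1, hr⟩ := exists_modulus_contraction hE.one_lt hC0
  refine ⟨A, r, hA, hr0, hr1, fun h H hH hper hmod => ?_⟩
  have hA0 : 0 ≤ A := zero_le_one.trans hA
  refine (hE.periodic_transferOp hper).sub_le_of_dist_le_one
    (ω := fun t => H * r * (1 - Real.exp (-(A * t)))) ?_ ?_
  · intro s t hst
    dsimp only
    gcongr
  intro x y hxy
  have := sum_mul_sub_sum_mul_le (s := range n) (p := fun j => branchWeight F G ρ j x)
    (q := fun j => branchWeight F G ρ j y) (a := fun j => h (G (x + j)))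
    (a' := fun j => h (G (y + j))) (c := Real.exp (-(C * |x - y|)))
    (D := H * (1 - Real.exp (-(A * (|x - y| / lam))))) (H := H)
    (by simpa using hE.degree_pos.ne') (fun j _ => (hE.branchWeight_pos j x).le)
    (hE.sum_branchWeight x) (hE.sum_branchWeight y) (Real.exp_pos _).le (fun j _ => hC j x y)
    (fun j _ => (hmod _ _).trans ?_) (fun i _ j _ => (hmod _ _).trans ?_)
  · refine this.trans ?_
    have := mul_le_mul_of_nonneg_left (hr |x - y| (abs_nonneg _) hxy) hH
    linarith
  · have := hE.abs_inv_sub_le (x + j) (y + j)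
    rw [add_sub_add_right_eq_sub] at this
    gcongr
  · have := Real.exp_pos (-(A * |G (x + i) - G (y + j)|))
    nlinarith

section Iterates

variable {b : ℝ → ℝ}

lemma continuous_iterate_transferOp (hE : IsExpandingLift F G ρ n lam) (hb : Continuous b)
    (k : ℕ) : Continuous ((transferOp F G ρ n)^[k] b) := by
  induction k with
  | zero => exact hb
  | succ k ih => rw [Function.iterate_succ_apply']; exact hE.continuous_transferOp ih

lemma periodic_iterate_transferOp (hE : IsExpandingLift F G ρ n lam)
    (hb : Function.Periodic b 1) (k : ℕ) : Function.Periodic ((transferOp F G ρ n)^[k] b) 1 := by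
  induction k with
  | zero => exact hb
  | succ k ih => rw [Function.iterate_succ_apply']; exact hE.periodic_transferOp ih

lemma periodic_comp_iterate (hE : IsExpandingLift F G ρ n lam) {g : ℝ → ℝ}
    (hg : Function.Periodic g 1) (k : ℕ) : Function.Periodic (fun x => g (F^[k] x)) 1 := by
  induction k with
  | zero => exact hg
  | succ k ih => simpa only [Function.iterate_succ_apply] using ih.comp_lift hE.map_add_one

lemma integral_mul_comp_iterate (hE : IsExpandingLift F G ρ n lam) {g : ℝ → ℝ}
    (hb : Continuous b) (hbp : Function.Periodic b 1) (hg : Continuous g)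
    (hgp : Function.Periodic g 1) (k : ℕ) :
    ∫ x in (0 : ℝ)..1, ρ x * (b x * g (F^[k] x))
      = ∫ x in (0 : ℝ)..1, ρ x * ((transferOp F G ρ n)^[k] b x * g x) := by
  induction k generalizing b with
  | zero => rfl
  | succ k ih =>
    simp only [Function.iterate_succ_apply]
    rw [← ih (hE.continuous_transferOp hb) (hE.periodic_transferOp hbp)]
    exact hE.integral_mul_comp hb hbp
      (hg.comp (hE.contDiff.continuous.iterate k)) (hE.periodic_comp_iterate hgp k)

/-- Exponential decay of the iterates of the transfer operator on centred functions. -/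
lemma exists_iterate_bound (hE : IsExpandingLift F G ρ n lam) (hb : ContDiff ℝ 1 b)
    (hbp : Function.Periodic b 1) (hb0 : ∫ x in (0 : ℝ)..1, ρ x * b x = 0) :
    ∃ H r : ℝ, 0 < r ∧ r < 1 ∧ ∀ k x, |(transferOp F G ρ n)^[k] b x| ≤ H * r ^ k := by
  obtain ⟨A, r, hA, hr0, hr1, hcontr⟩ := hE.exists_contraction
  obtain ⟨K, hK0, hK⟩ := hbp.exists_lipschitz hb
  have hρ := hE.density_contDiff.continuous
  have hmod : ∀ k x y, (transferOp F G ρ n)^[k] b x - (transferOp F G ρ n)^[k] b y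
      ≤ 2 * K * r ^ k * (1 - Real.exp (-(A * |x - y|))) := by
    intro k
    induction k with
    | zero =>
      refine hbp.sub_le_of_dist_le_one
        (ω := fun t => 2 * K * r ^ 0 * (1 - Real.exp (-(A * t)))) ?_ fun x y hxy => ?_
      · intro s t hst
        have : 0 ≤ A := zero_le_one.trans hA
        dsimp only
        gcongr
      · have h1 := half_le_one_sub_exp_neg (abs_nonneg (x - y)) hxy
        have h2 : Real.exp (-(A * |x - y|)) ≤ Real.exp (-|x - y|) :=
          Real.exp_le_exp.2 (by nlinarith [abs_nonneg (x - y)])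
        have h3 := (le_abs_self _).trans (hK x y)
        simp only [pow_zero, mul_one]
        nlinarith
    | succ k ih =>
      simp only [Function.iterate_succ_apply', pow_succ, ← mul_assoc]
      exact hcontr _ _ (by positivity) (hE.periodic_iterate_transferOp hbp k) ih
  refine ⟨2 * K, r, hr0, hr1, fun k x => ?_⟩
  set u := (transferOp F G ρ n)^[k] b with hu
  have huc : Continuous u := hE.continuous_iterate_transferOp hb.continuous k
  have hosc : ∀ x y, u x - u y ≤ 2 * K * r ^ k := fun x y => (hmod k x y).trans
    (mul_le_of_le_one_right (by positivity) (by linarith [Real.exp_pos (-(A * |x - y|))]))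
  have hmean : ∫ z in (0 : ℝ)..1, ρ z * u z = 0 := by
    have := hE.integral_mul_comp_iterate hb.continuous hbp (g := fun _ => 1) continuous_const
      (fun _ => rfl) k
    simp only [mul_one] at this
    rw [← this, hb0]
  have hrep : u x = ∫ z in (0 : ℝ)..1, ρ z * (u x - u z) := by
    simp only [mul_sub]
    rw [intervalIntegral.integral_sub (Continuous.intervalIntegrable (by fun_prop) _ _)
      (Continuous.intervalIntegrable (by fun_prop) _ _), hmean,
      intervalIntegral.integral_mul_const, hE.integral_density]
    ring
  have hbound : ∫ z in (0 : ℝ)..1, ρ z * (2 * K * r ^ k) = 2 * K * r ^ k := by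
    rw [intervalIntegral.integral_mul_const, hE.integral_density, one_mul]
  rw [hrep, ← hbound]
  rw [← Real.norm_eq_abs]
  refine intervalIntegral.norm_integral_le_of_norm_le zero_le_one
    (ae_of_all _ fun z _ => ?_)
    ((hρ.mul continuous_const).intervalIntegrable _ _)
  rw [norm_mul, Real.norm_of_nonneg (hE.density_pos z).le]
  refine mul_le_mul_of_nonneg_left ?_ (hE.density_pos z).le
  exact abs_le.2 ⟨by linarith [hosc z x], hosc x z⟩

/-- The martingale approximation: `b` is cohomologous to `b + w - w ∘ F`, whose variance is the
Green–Kubo coefficient. -/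
lemma exists_martingale_approximation (hE : IsExpandingLift F G ρ n lam) (hb : ContDiff ℝ 1 b)
    (hbp : Function.Periodic b 1) (hb0 : ∫ x in (0 : ℝ)..1, ρ x * b x = 0) :
    ∃ w : ℝ → ℝ, Continuous w ∧ Function.Periodic w 1 ∧
      (Summable fun k : ℕ => ∫ x in (0 : ℝ)..1, b x * b (F^[k + 1] x) * ρ x) ∧
      gammaCoef F b ρ = ∫ x in (0 : ℝ)..1, ρ x * (b x + w x - w (F x)) ^ 2 := by
  obtain ⟨H, r, hr0, hr1, hbd⟩ := hE.exists_iterate_bound hb hbp hb0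
  have hbc := hb.continuous
  have hρ := hE.density_contDiff.continuous
  have hFc := hE.contDiff.continuous
  have hgeom : Summable fun k : ℕ => H * r ^ (k + 1) :=
    ((summable_nat_add_iff 1).2 (summable_geometric_of_lt_one hr0.le hr1)).mul_left H
  have hgeom0 : Summable fun k : ℕ => H * r ^ k :=
    (summable_geometric_of_lt_one hr0.le hr1).mul_left H
  set u : ℕ → ℝ → ℝ := fun k => (transferOp F G ρ n)^[k] b with hu
  have huc : ∀ k, Continuous (u k) := hE.continuous_iterate_transferOp hbc
  have hus : ∀ x, Summable fun k => u k x := fun x => hgeom0.of_norm_bounded (hbd · x)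
  set w : ℝ → ℝ := fun x => ∑' k, u (k + 1) x with hw
  have hwc : Continuous w := continuous_tsum (fun k => huc (k + 1)) hgeom fun k x => hbd (k + 1) x
  have hwp : Function.Periodic w 1 := fun x => by
    simp only [hw]
    exact tsum_congr fun k => hE.periodic_iterate_transferOp hbp (k + 1) x
  have hv : ∀ x, HasSum (fun k => u k x) (b x + w x) := fun x => by
    have := (hus x).hasSum
    rwa [(hus x).tsum_eq_zero_add] at this
  have hLv : ∀ y, transferOp F G ρ n (fun x => b x + w x) y = w y := by
    intro y
    have h1 : HasSum (fun k => u (k + 1) y) (transferOp F G ρ n (fun x => b x + w x) y) := by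
      simp only [hu, Function.iterate_succ_apply']
      exact hasSum_sum fun j _ => (hv (G (y + j))).mul_left _
    exact h1.tsum_eq.symm
  have hsum : HasSum (fun k : ℕ => ∫ x in (0 : ℝ)..1, b x * b (F^[k + 1] x) * ρ x)
      (∫ x in (0 : ℝ)..1, ρ x * (w x * b x)) := by
    have hcorr : ∀ k : ℕ, ∫ x in (0 : ℝ)..1, b x * b (F^[k + 1] x) * ρ x
        = ∫ x in (0 : ℝ)..1, ρ x * (u (k + 1) x * b x) := fun k => by
      rw [← hE.integral_mul_comp_iterate hbc hbp hbc hbp (k + 1)]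
      exact intervalIntegral.integral_congr fun x _ => mul_comm _ _
    simp only [hcorr]
    refine intervalIntegral.hasSum_integral_of_dominated_convergence
      (fun k x => ρ x * (H * r ^ (k + 1) * |b x|))
      (fun k => Continuous.aestronglyMeasurable (by have := huc (k + 1); fun_prop))
      (fun k => ae_of_all _ fun x _ => ?_)
      (ae_of_all _ fun x _ => (hgeom.mul_right _).mul_left _)
      ?_ (ae_of_all _ fun x _ => ?_)
    · rw [norm_mul, norm_mul, Real.norm_of_nonneg (hE.density_pos x).le]
      exact mul_le_mul_of_nonneg_left
        (mul_le_mul_of_nonneg_right (hbd (k + 1) x) (abs_nonneg _)) (hE.density_pos x).le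
    · simp only [tsum_mul_left, tsum_mul_right]
      exact Continuous.intervalIntegrable (by fun_prop) _ _
    · exact (((summable_nat_add_iff 1).2 (hus x)).hasSum.mul_right _).mul_left _
  refine ⟨w, hwc, hwp, hsum.summable, ?_⟩
  have hdual := hE.integral_mul_comp (h := fun x => b x + w x) (by fun_prop)
    (hbp.add hwp) hwc hwp
  simp only [hLv] at hdual
  have hinv := hE.invariant (fun x => w x * w x) (by fun_prop) (hwp.mul hwp)
  have hexpand : ∫ x in (0 : ℝ)..1, ρ x * (b x + w x - w (F x)) ^ 2
      = (∫ x in (0 : ℝ)..1, ρ x * (b x + w x) ^ 2)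
        - 2 * (∫ x in (0 : ℝ)..1, ρ x * ((b x + w x) * w (F x)))
        + ∫ x in (0 : ℝ)..1, ρ x * (w (F x) * w (F x)) := by
    rw [← intervalIntegral.integral_const_mul, ← intervalIntegral.integral_sub
      (Continuous.intervalIntegrable (by fun_prop) _ _)
      (Continuous.intervalIntegrable (by fun_prop) _ _), ← intervalIntegral.integral_add
      (Continuous.intervalIntegrable (by fun_prop) _ _)
      (Continuous.intervalIntegrable (by fun_prop) _ _)]
    exact intervalIntegral.integral_congr fun x _ => by ring
  rw [hexpand, hdual, hinv, gammaCoef, hsum.tsum_eq, ← intervalIntegral.integral_const_mul,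
    ← intervalIntegral.integral_const_mul, ← intervalIntegral.integral_sub
      (Continuous.intervalIntegrable (by fun_prop) _ _)
      (Continuous.intervalIntegrable (by fun_prop) _ _), ← intervalIntegral.integral_add
      (Continuous.intervalIntegrable (by fun_prop) _ _)
      (Continuous.intervalIntegrable (by fun_prop) _ _), ← intervalIntegral.integral_add
      (Continuous.intervalIntegrable (by fun_prop) _ _)
      (Continuous.intervalIntegrable (by fun_prop) _ _)]
  exact intervalIntegral.integral_congr fun x _ => by ring

end Iterates

/-- The correlation series of a coboundary telescopes. -/
lemma gammaCoef_eq_zero_of_coboundary (hE : IsExpandingLift F G ρ n lam) {b ζ : ℝ → ℝ}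
    (hζ : Continuous ζ) (hζp : Function.Periodic ζ 1) (hbζ : ∀ x, b x = ζ x - ζ (F x))
    (hsum : Summable fun k : ℕ => ∫ x in (0 : ℝ)..1, b x * b (F^[k + 1] x) * ρ x) :
    gammaCoef F b ρ = 0 := by
  have hρ := hE.density_contDiff.continuous
  have hFc := hE.contDiff.continuous
  have hFk : ∀ k, Continuous (F^[k]) := hFc.iterate
  set c : ℕ → ℝ := fun k => ∫ x in (0 : ℝ)..1, ρ x * (ζ x * ζ (F^[k] x)) with hc
  have hshift : ∀ k, ∫ x in (0 : ℝ)..1, ρ x * (ζ (F x) * ζ (F^[k] (F x))) = c k := fun k =>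
    hE.invariant (fun x => ζ x * ζ (F^[k] x)) (by have := hFk k; fun_prop)
      (hζp.mul (hE.periodic_comp_iterate hζp k))
  have hii : ∀ {g : ℝ → ℝ}, Continuous g → IntervalIntegrable g volume 0 1 :=
    fun hg => hg.intervalIntegrable _ _
  have hcorr : ∀ k : ℕ, ∫ x in (0 : ℝ)..1, b x * b (F^[k + 1] x) * ρ x
      = (c (k + 1) - c k) - (c (k + 2) - c (k + 1)) := by
    intro k
    have h1 := hFk k
    have h2 := hFk (k + 1)
    have h3 := hFk (k + 2)
    have hs := hshift (k + 1)
    have hs' := hshift k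
    have : ∫ x in (0 : ℝ)..1, b x * b (F^[k + 1] x) * ρ x
        = ((∫ x in (0 : ℝ)..1, ρ x * (ζ x * ζ (F^[k + 1] x)))
          - ∫ x in (0 : ℝ)..1, ρ x * (ζ (F x) * ζ (F^[k] (F x))))
          - ((∫ x in (0 : ℝ)..1, ρ x * (ζ x * ζ (F^[k + 2] x)))
          - ∫ x in (0 : ℝ)..1, ρ x * (ζ (F x) * ζ (F^[k + 1] (F x)))) := by
      rw [← intervalIntegral.integral_sub (hii (by fun_prop)) (hii (by fun_prop)),
        ← intervalIntegral.integral_sub (hii (by fun_prop)) (hii (by fun_prop)),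
        ← intervalIntegral.integral_sub (hii (by fun_prop)) (hii (by fun_prop))]
      refine intervalIntegral.integral_congr fun x _ => ?_
      simp only [hbζ, ← Function.iterate_succ_apply' F, ← Function.iterate_succ_apply F]
      ring
    rw [this, hs, hs']
  have hsq : ∫ x in (0 : ℝ)..1, b x ^ 2 * ρ x = -2 * (c 1 - c 0) := by
    have hs := hshift 0
    have : ∫ x in (0 : ℝ)..1, b x ^ 2 * ρ x
        = ((∫ x in (0 : ℝ)..1, ρ x * (ζ x * ζ (F^[0] x)))
          + ∫ x in (0 : ℝ)..1, ρ x * (ζ (F x) * ζ (F^[0] (F x))))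
          - 2 * ∫ x in (0 : ℝ)..1, ρ x * (ζ x * ζ (F^[1] x)) := by
      rw [← intervalIntegral.integral_const_mul]
      simp only [Function.iterate_zero, Function.iterate_one, id]
      rw [← intervalIntegral.integral_add (hii (by fun_prop)) (hii (by fun_prop)),
        ← intervalIntegral.integral_sub (hii (by fun_prop)) (hii (by fun_prop))]
      refine intervalIntegral.integral_congr fun x _ => ?_
      simp only [hbζ]
      ring
    rw [this, hs]
    ring
  obtain ⟨K, hK0, hK⟩ := hζp.exists_abs_le hζ
  have hcb : ∀ k, |c k| ≤ K * K := by
    intro k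
    have : ∫ x in (0 : ℝ)..1, ρ x * (K * K) = K * K := by
      rw [intervalIntegral.integral_mul_const, hE.integral_density, one_mul]
    rw [← this]
    rw [← Real.norm_eq_abs]
    refine intervalIntegral.norm_integral_le_of_norm_le zero_le_one
      (ae_of_all _ fun z _ => ?_) (hii (hρ.mul continuous_const))
    rw [norm_mul, norm_mul, Real.norm_of_nonneg (hE.density_pos z).le]
    have := hK z
    have := hK (F^[k] z)
    have := (hE.density_pos z).le
    simp only [Real.norm_eq_abs]
    gcongr
  have hpart : ∀ N, ∑ k ∈ range N, ∫ x in (0 : ℝ)..1, b x * b (F^[k + 1] x) * ρ x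
      = (c 1 - c 0) - (c (N + 1) - c N) := by
    intro N
    simp only [hcorr]
    exact Finset.sum_range_sub' (fun k => c (k + 1) - c k) N
  have hlim := hsum.hasSum.tendsto_sum_nat
  simp only [hpart] at hlim
  set S := ∑' k : ℕ, ∫ x in (0 : ℝ)..1, b x * b (F^[k + 1] x) * ρ x with hS
  have hlim' : Filter.Tendsto (fun N => c (N + 1) - c N) Filter.atTop
      (nhds ((c 1 - c 0) - S)) := by
    simpa using hlim.const_sub (c 1 - c 0)
  have hces := hlim'.cesaro
  simp only [Finset.sum_range_sub] at hces
  have hzero : Filter.Tendsto (fun N : ℕ => (N : ℝ)⁻¹ * (c N - c 0)) Filter.atTop (nhds 0) := by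
    refine squeeze_zero_norm (a := fun N : ℕ => (N : ℝ)⁻¹ * (K * K + K * K)) (fun N => ?_) ?_
    · rw [norm_mul, norm_inv, Real.norm_natCast]
      gcongr
      exact (norm_sub_le _ _).trans (add_le_add (hcb N) (hcb 0))
    · simpa using (tendsto_inv_atTop_nhds_zero_nat (𝕜 := ℝ)).mul_const (K * K + K * K)
  have := tendsto_nhds_unique hces hzero
  rw [gammaCoef, hsq, ← hS]
  linarith

end IsExpandingLift

lemma exists_isExpandingLift {F ρ : ℝ → ℝ} {d : ℤ} {lam : ℝ} (hF : ContDiff ℝ 2 F)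
    (hFlift : ∀ x, F (x + 1) = F x + d) (hlam : 1 < lam) (hexp : ∀ x, lam ≤ deriv F x)
    (hρper : Function.Periodic ρ 1) (hρC1 : ContDiff ℝ 1 ρ) (hρpos : ∀ x, 0 < ρ x)
    (hρnorm : ∫ x in (0 : ℝ)..1, ρ x = 1)
    (hρinv : ∀ g : ℝ → ℝ, Continuous g → Function.Periodic g 1 →
      ∫ x in (0 : ℝ)..1, ρ x * g (F x) = ∫ x in (0 : ℝ)..1, ρ x * g x) :
    ∃ (G : ℝ → ℝ) (n : ℕ), IsExpandingLift F G ρ n lam := by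
  have hlam0 : 0 < lam := zero_lt_one.trans hlam
  have hmono : StrictMono F := strictMono_of_deriv_pos fun x => hlam0.trans_le (hexp x)
  have hd : 0 ≤ d := by
    have h := hmono (show (0 : ℝ) < 0 + 1 by norm_num)
    rw [hFlift] at h
    exact_mod_cast ((lt_add_iff_pos_right _).1 h).le
  have hgrow : ∀ x y, x ≤ y → lam * (y - x) ≤ F y - F x := fun x y hxy =>
    mul_sub_le_image_sub_of_le_deriv (hF.differentiable two_ne_zero) hexp hxy
  have hsurj : Function.Surjective F := by
    refine hF.continuous.surjective ?_ ?_
    · refine Filter.tendsto_atTop_mono' _ (f₁ := fun x => lam * x + F 0) ?_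
        (Filter.tendsto_atTop_add_const_right _ _ (Filter.tendsto_id.const_mul_atTop hlam0))
      filter_upwards [Filter.eventually_ge_atTop 0] with x hx
      linarith [hgrow 0 x hx]
    · refine Filter.tendsto_atBot_mono' _ (f₁ := fun x => lam * x + F 0) ?_
        (Filter.tendsto_atBot_add_const_right _ _ (Filter.tendsto_id.const_mul_atBot hlam0))
      filter_upwards [Filter.eventually_le_atBot 0] with x hx
      linarith [hgrow x 0 hx]
  obtain ⟨G, hG⟩ := hsurj.hasRightInverse
  lift d to ℕ using hd
  exact ⟨G, d, hF, by simpa using hFlift, hlam, hexp, fun x => hmono.injective (hG (F x)), hG,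
    hρper, hρC1, hρpos, hρnorm, hρinv⟩

/-- **Coboundary characterization of `γ = 0`**. -/
theorem gamma_eq_zero_iff_coboundary
    (F : ℝ → ℝ) (hF : ContDiff ℝ (⊤ : ℕ∞) F) (d : ℤ) (hFlift : ∀ x, F (x + 1) = F x + d)
    (lam : ℝ) (hlam : 1 < lam) (hexp : ∀ x, lam ≤ deriv F x)
    (ρstar : ℝ → ℝ) (hρper : Function.Periodic ρstar 1) (hρC1 : ContDiff ℝ 1 ρstar)
    (hρpos : ∀ x, 0 < ρstar x) (hρnorm : (∫ x in (0:ℝ)..1, ρstar x) = 1)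
    (hρinv : ∀ g : ℝ → ℝ, Continuous g → Function.Periodic g 1 →
        (∫ x in (0:ℝ)..1, ρstar x * g (F x)) = ∫ x in (0:ℝ)..1, ρstar x * g x)
    (b : ℝ → ℝ) (hb : ContDiff ℝ (⊤ : ℕ∞) b) (hbper : Function.Periodic b 1)
    (hbmean : (∫ x in (0:ℝ)..1, b x * ρstar x) = 0) :
    gammaCoef F b ρstar = 0 ↔
      ∃ ζ : ℝ → ℝ, Continuous ζ ∧ Function.Periodic ζ 1 ∧ ∀ θ, b θ = ζ θ - ζ (F θ) := by
  obtain ⟨G, n, hE⟩ := exists_isExpandingLift (hF.of_le (WithTop.coe_le_coe.2 le_top)) hFlift hlam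
    hexp hρper hρC1 hρpos hρnorm hρinv
  have hbmean' : ∫ x in (0 : ℝ)..1, ρstar x * b x = 0 := by simpa only [mul_comm] using hbmean
  obtain ⟨w, hwc, hwp, hsum, hgamma⟩ :=
    hE.exists_martingale_approximation (hb.of_le (by exact_mod_cast le_top)) hbper hbmean'
  refine ⟨fun h0 => ⟨fun x => -w x, hwc.neg, fun x => congrArg Neg.neg (hwp x), fun x => ?_⟩, ?_⟩
  · have hFc := hF.continuous
    have hbc := hb.continuous
    have := eq_zero_of_integral_mul_sq_eq_zero (g := fun x => b x + w x - w (F x))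
      hρC1.continuous hρpos (by fun_prop) ((hbper.add hwp).sub (hwp.comp_lift hE.map_add_one))
      (hgamma ▸ h0) x
    linarith
  · rintro ⟨ζ, hζ, hζp, hbζ⟩
    exact hE.gammaCoef_eq_zero_of_coboundary hζ hζp hbζ hsum

end
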